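/- Let u ∈ ℓ²(ℕ, ℂ). Finitely supported sequences are dense in Dom Γ_u with respect to the graph norm: for every f ∈ Dom Γ_u and every ε > 0 there exists a finitely supported p : ℕ → ℂ such that ‖f − p‖² + ‖Γ_u f − Γ_u p‖² < ε². -/

import Mathlib

open scoped ComplexConjugate
open Filter

noncomputable section

/-- `ℓ²(ℕ, ℂ)`. -/
abbrev ellTwo : Type := lp (fun _ : ℕ => ℂ) 2

/-- The (maximal) Hankel matrix action with symbol `u`: `(Γ_u f)(m) = ∑_{n} u(n+m) f(n)`. -/
def hankel (u f : ℕ → ℂ) : ℕ → ℂ := fun m => ∑' n : ℕ, u (n + m) * f n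

/-- Finitely supported sequences. -/
def FinSupp (p : ℕ → ℂ) : Prop := ∃ N, ∀ n ≥ N, p n = 0

open Polynomial in
/-- The tail `∑_{n < N - m} a (m + n) Xⁿ`. -/
def tailPoly (a : ℕ → ℂ) (N m : ℕ) : ℂ[X] :=
  ∑ n ∈ Finset.range (N - m), C (a (m + n)) * X ^ n

open Polynomial in
/-- The truncated Herglotz polynomial of `a`: its real part on the unit circle is
`|∑_{n < N} a n zⁿ|²`. -/
def herglotzPoly (a : ℕ → ℂ) (N : ℕ) : ℂ[X] :=
  ∑ m ∈ Finset.range N, C (conj (a m)) * (C 2 * tailPoly a N m - C (a m))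

open Polynomial in
theorem tailPoly_eq_add {a : ℕ → ℂ} {N m : ℕ} (h : m < N) :
    tailPoly a N m = C (a m) + X * tailPoly a N (m + 1) := by
  obtain ⟨k, rfl⟩ : ∃ k, N = m + 1 + k := ⟨N - (m + 1), by omega⟩
  have h₁ : m + 1 + k - m = k + 1 := by omega
  have h₂ : m + 1 + k - (m + 1) = k := by omega
  simp only [tailPoly, h₁, h₂, Finset.sum_range_succ', Finset.mul_sum]
  rw [add_comm]
  congr 1
  · simp
  · refine Finset.sum_congr rfl fun n _ => ?_
    rw [show m + (n + 1) = m + 1 + n by ring]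
    ring

theorem tailPoly_self (a : ℕ → ℂ) (N : ℕ) : tailPoly a N N = 0 := by
  simp [tailPoly]

theorem norm_coeff_tailPoly_le (a : ℕ → ℂ) (N m k : ℕ) :
    ‖(tailPoly a N m).coeff k‖ ≤ ‖a (m + k)‖ := by
  simp only [tailPoly, Polynomial.finsetSum_coeff, Polynomial.coeff_C_mul, Polynomial.coeff_X_pow,
    mul_ite, mul_one, mul_zero, Finset.sum_ite_eq]
  split_ifs <;> simp

theorem norm_coeff_herglotzPoly_le (a : ellTwo) (N k : ℕ) :
    ‖(herglotzPoly (⇑a) N).coeff k‖ ≤ 3 * ‖a‖ ^ 2 := by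
  have hsum (s : Finset ℕ) : ∑ i ∈ s, ‖a i‖ ^ 2 ≤ ‖a‖ ^ 2 := by
    simpa using lp.sum_rpow_le_norm_rpow (p := 2) (by norm_num) a s
  have hterm (m : ℕ) : ‖(Polynomial.C (conj (a m)) *
      (Polynomial.C 2 * tailPoly a N m - Polynomial.C (a m))).coeff k‖ ≤
      2 * ‖a m‖ ^ 2 + ‖a (m + k)‖ ^ 2 := by
    have h₁ := norm_coeff_tailPoly_le a N m k
    have h₂ : ‖(Polynomial.C (a m)).coeff k‖ ≤ ‖a m‖ := by
      rw [Polynomial.coeff_C]; split_ifs <;> simp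
    rw [Polynomial.coeff_C_mul, Polynomial.coeff_sub, Polynomial.coeff_C_mul, two_mul, norm_mul,
      RCLike.norm_conj]
    have h₃ := norm_sub_le ((tailPoly a N m).coeff k + (tailPoly a N m).coeff k)
      ((Polynomial.C (a m)).coeff k)
    have h₄ := norm_add_le ((tailPoly a N m).coeff k) ((tailPoly a N m).coeff k)
    have h₅ := mul_le_mul_of_nonneg_left (h₃.trans (by linarith :
      _ ≤ 2 * ‖a (m + k)‖ + ‖a m‖)) (norm_nonneg (a m))
    nlinarith [sq_nonneg (‖a m‖ - ‖a (m + k)‖)]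
  calc ‖(herglotzPoly (⇑a) N).coeff k‖
      ≤ ∑ m ∈ Finset.range N, (2 * ‖a m‖ ^ 2 + ‖a (m + k)‖ ^ 2) := by
        rw [herglotzPoly, Polynomial.finsetSum_coeff]
        exact norm_sum_le_of_le _ fun m _ => hterm m
    _ ≤ 3 * ‖a‖ ^ 2 := by
        rw [Finset.sum_add_distrib, ← Finset.mul_sum]
        have h₁ := hsum (Finset.range N)
        have h₂ := hsum ((Finset.range N).map (addRightEmbedding k))
        simp only [Finset.sum_map, addRightEmbedding_apply] at h₂
        linarith

section Contraction

variable {H : Type*} [NormedAddCommGroup H] [InnerProductSpace ℂ H]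

theorem norm_sq_aeval_tailPoly_le {U : H →L[ℂ] H} (hU : ‖U‖ ≤ 1) (a : ℕ → ℂ) (N : ℕ) (v : H) :
    ‖Polynomial.aeval U (tailPoly a N 0) v‖ ^ 2 ≤
      (inner ℂ v (Polynomial.aeval U (herglotzPoly a N) v)).re := by
  set q : ℕ → H := fun m => Polynomial.aeval U (tailPoly a N m) v with hq
  have hqN : q N = 0 := by simp [hq, tailPoly_self]
  have hstep (m : ℕ) (hm : m < N) : q m = a m • v + U (q (m + 1)) := by
    simp only [hq]
    rw [tailPoly_eq_add hm]
    simp [Algebra.algebraMap_eq_smul_one]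
  have hterm (m : ℕ) (hm : m < N) : ‖q m‖ ^ 2 - ‖q (m + 1)‖ ^ 2 ≤
      (inner ℂ (a m • v) ((2 : ℂ) • q m - a m • v)).re := by
    have h₁ : ‖U (q (m + 1))‖ ≤ ‖q (m + 1)‖ := by
      simpa using U.le_of_opNorm_le hU (q (m + 1))
    have h₂ : U (q (m + 1)) = q m - a m • v := by rw [hstep m hm]; abel
    have h₃ : ‖q m - a m • v‖ ^ 2 ≤ ‖q (m + 1)‖ ^ 2 := by
      rw [← h₂]; gcongr
    have h₄ := norm_sub_sq (𝕜 := ℂ) (q m) (a m • v)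
    have h₅ : (inner ℂ (a m • v) (q m)).re = (inner ℂ (q m) (a m • v)).re :=
      inner_re_symm (𝕜 := ℂ) _ _
    have h₆ : (inner ℂ (a m • v) (a m • v)).re = ‖a m • v‖ ^ 2 :=
      inner_self_eq_norm_sq (𝕜 := ℂ) _
    rw [inner_sub_right, inner_smul_right, Complex.sub_re, h₆]
    simp only [Complex.mul_re, Complex.re_ofNat, Complex.im_ofNat, zero_mul, sub_zero, h₅]
    simp only [RCLike.re_eq_complex_re] at h₄
    linarith
  have hF : inner ℂ v (Polynomial.aeval U (herglotzPoly a N) v) =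
      ∑ m ∈ Finset.range N, inner ℂ (a m • v) ((2 : ℂ) • q m - a m • v) := by
    simp only [herglotzPoly, map_sum, map_mul, map_sub, Polynomial.aeval_C,
      Algebra.algebraMap_eq_smul_one, sum_apply, inner_sum]
    refine Finset.sum_congr rfl fun m _ => ?_
    rw [inner_smul_left, ← inner_smul_right]
    simp [hq]
  rw [hF, Complex.re_sum]
  calc ‖q 0‖ ^ 2 = ∑ m ∈ Finset.range N, (‖q m‖ ^ 2 - ‖q (m + 1)‖ ^ 2) := by
        rw [Finset.sum_range_sub', hqN]; simp
    _ ≤ _ := Finset.sum_le_sum fun m hm => hterm m (Finset.mem_range.1 hm)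

/-- `1 + t F`, with `F` the Herglotz polynomial of `a`. -/
def regularizer (a : ℕ → ℂ) (N : ℕ) (t : ℝ) : Polynomial ℂ :=
  1 + Polynomial.C (t : ℂ) * herglotzPoly a N

theorem aeval_regularizer_apply (U : H →L[ℂ] H) (a : ℕ → ℂ) (N : ℕ) (t : ℝ) (v : H) :
    Polynomial.aeval U (regularizer a N t) v =
      v + (t : ℂ) • Polynomial.aeval U (herglotzPoly a N) v := by
  simp [regularizer, Algebra.algebraMap_eq_smul_one]

theorem regularizer_coercive {U : H →L[ℂ] H} (hU : ‖U‖ ≤ 1) (a : ℕ → ℂ) (N : ℕ) {t : ℝ}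
    (ht : 0 ≤ t) (v : H) :
    ‖v‖ ^ 2 + t * ‖Polynomial.aeval U (tailPoly a N 0) v‖ ^ 2 ≤
      (inner ℂ v (Polynomial.aeval U (regularizer a N t) v)).re := by
  have h₁ : (inner ℂ v v).re = ‖v‖ ^ 2 := inner_self_eq_norm_sq (𝕜 := ℂ) v
  rw [aeval_regularizer_apply, inner_add_right, inner_smul_right, Complex.add_re, h₁,
    Complex.re_ofReal_mul]
  gcongr
  exact norm_sq_aeval_tailPoly_le hU a N v

theorem norm_le_norm_aeval_regularizer {U : H →L[ℂ] H} (hU : ‖U‖ ≤ 1) (a : ℕ → ℂ) (N : ℕ) {t : ℝ}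
    (ht : 0 ≤ t) (v : H) : ‖v‖ ≤ ‖Polynomial.aeval U (regularizer a N t) v‖ := by
  have h₁ := regularizer_coercive hU a N ht v
  have h₂ := re_inner_le_norm (𝕜 := ℂ) v (Polynomial.aeval U (regularizer a N t) v)
  simp only [RCLike.re_eq_complex_re] at h₂
  have h₃ : 0 ≤ t * ‖Polynomial.aeval U (tailPoly a N 0) v‖ ^ 2 := by positivity
  by_contra! h
  nlinarith [norm_nonneg (Polynomial.aeval U (regularizer a N t) v)]

theorem mul_norm_sq_aeval_tailPoly_le {U : H →L[ℂ] H} (hU : ‖U‖ ≤ 1) (a : ℕ → ℂ) (N : ℕ) {t : ℝ}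
    (ht : 0 ≤ t) (v : H) : t * ‖Polynomial.aeval U (tailPoly a N 0) v‖ ^ 2 ≤
      ‖Polynomial.aeval U (regularizer a N t) v‖ ^ 2 := by
  have h₁ := regularizer_coercive hU a N ht v
  have h₂ := re_inner_le_norm (𝕜 := ℂ) v (Polynomial.aeval U (regularizer a N t) v)
  simp only [RCLike.re_eq_complex_re] at h₂
  nlinarith [norm_le_norm_aeval_regularizer hU a N ht v, norm_nonneg v, sq_nonneg ‖v‖]

theorem exists_aeval_regularizer_eq [CompleteSpace H] {U : H →L[ℂ] H} (hU : ‖U‖ ≤ 1)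
    (a : ℕ → ℂ) (N : ℕ) {t : ℝ} (ht : 0 ≤ t) (w : H) :
    ∃ v, Polynomial.aeval U (regularizer a N t) v = w := by
  have hunit : IsUnit (Polynomial.aeval U (regularizer a N t)) := by
    refine ContinuousLinearMap.isUnit_of_forall_le_norm_inner_map _ one_pos fun v => ?_
    rw [norm_inner_symm, NNReal.coe_one, mul_one]
    have h₃ : 0 ≤ t * ‖Polynomial.aeval U (tailPoly a N 0) v‖ ^ 2 := by positivity
    linarith [regularizer_coercive hU a N ht v,
      Complex.re_le_norm (inner ℂ v (Polynomial.aeval U (regularizer a N t) v))]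
  exact (ContinuousLinearMap.isUnit_iff_bijective.1 hunit).2 w

theorem aeval_apply_mem {U : H →L[ℂ] H} {V : Submodule ℂ H} (hV : ∀ v ∈ V, U v ∈ V)
    (P : Polynomial ℂ) {v : H} (hv : v ∈ V) : Polynomial.aeval U P v ∈ V := by
  induction P using Polynomial.induction_on' with
  | add P Q hP hQ => simpa using V.add_mem hP hQ
  | monomial n c =>
    rw [← Polynomial.C_mul_X_pow_eq_monomial]
    simp only [map_mul, map_pow, Polynomial.aeval_C, Polynomial.aeval_X,
      Algebra.algebraMap_eq_smul_one, smul_mul_assoc, one_mul, smul_apply]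
    refine V.smul_mem _ ?_
    induction n with
    | zero => simpa
    | succ n ih => rw [pow_succ']; exact hV _ ih

theorem map_aeval_apply {K : Type*} [NormedAddCommGroup K] [InnerProductSpace ℂ K]
    {U : H →L[ℂ] H} {W : K →L[ℂ] K} (T : H →L[ℂ] K) (hT : ∀ v, T (U v) = W (T v))
    (P : Polynomial ℂ) (v : H) :
    T (Polynomial.aeval U P v) = Polynomial.aeval W P (T v) := by
  induction P using Polynomial.induction_on' with
  | add P Q hP hQ => simp [hP, hQ]
  | monomial n c =>
    rw [← Polynomial.C_mul_X_pow_eq_monomial]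
    simp only [map_mul, map_pow, Polynomial.aeval_C, Polynomial.aeval_X,
      Algebra.algebraMap_eq_smul_one, smul_mul_assoc, one_mul, smul_apply,
      map_smul]
    congr 1
    induction n with
    | zero => simp
    | succ n ih => rw [pow_succ', pow_succ', mul_apply_eq_comp, hT, ih,
        mul_apply_eq_comp]

theorem exists_mem_aeval_regularizer_eq [CompleteSpace H] {U : H →L[ℂ] H} (hU : ‖U‖ ≤ 1)
    {V : Submodule ℂ H} (hVc : IsClosed (V : Set H)) (hV : ∀ v ∈ V, U v ∈ V)
    (a : ℕ → ℂ) (N : ℕ) {t : ℝ} (ht : 0 ≤ t) {w : H} (hw : w ∈ V) :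
    ∃ v ∈ V, Polynomial.aeval U (regularizer a N t) v = w := by
  have : CompleteSpace V := hVc.completeSpace_coe
  let UV : V →L[ℂ] V := (U.comp V.subtypeL).codRestrict V fun v => hV v v.2
  have hUV : ‖UV‖ ≤ 1 := by
    refine ContinuousLinearMap.opNorm_le_bound _ zero_le_one fun v => ?_
    simpa using! U.le_of_opNorm_le hU (v : H)
  obtain ⟨v, hv⟩ := exists_aeval_regularizer_eq hUV a N ht ⟨w, hw⟩
  refine ⟨v, v.2, ?_⟩
  have := map_aeval_apply (U := UV) (W := U) V.subtypeL (fun _ => rfl) (regularizer a N t) v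
  rw [hv] at this
  exact this.symm

end Contraction

theorem shiftFun_memℓp (f : ellTwo) :
    Memℓp (fun n : ℕ => if n = 0 then (0 : ℂ) else f (n - 1)) 2 := by
  refine memℓp_gen ((summable_nat_add_iff 1).1 ?_)
  simpa using (lp.memℓp f).summable (by norm_num)

/-- The unilateral shift on `ℓ²`. -/
def shift : ellTwo →L[ℂ] ellTwo :=
  LinearMap.mkContinuous
    { toFun := fun f => ⟨_, shiftFun_memℓp f⟩
      map_add' := fun f g => by
        ext n
        change _ = (if n = 0 then (0 : ℂ) else f (n - 1)) + if n = 0 then (0 : ℂ) else g (n - 1)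
        rcases n with _ | n <;> simp
      map_smul' := fun c f => by
        ext n
        rcases n with _ | n <;> simp } 1 fun f => by
    rw [one_mul]
    refine lp.norm_le_of_tsum_le (p := 2) (by norm_num) (norm_nonneg f) (le_of_eq ?_)
    rw [lp.norm_rpow_eq_tsum (by norm_num) f]
    refine (Summable.tsum_eq_zero_add ((shiftFun_memℓp f).summable (by norm_num))).trans ?_
    simp

@[simp]
theorem shift_apply_zero (f : ellTwo) : shift f 0 = 0 := rfl

@[simp]
theorem shift_apply_succ (f : ellTwo) (n : ℕ) : shift f (n + 1) = f n := rfl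

theorem norm_shift_le : ‖shift‖ ≤ 1 :=
  LinearMap.mkContinuous_norm_le _ zero_le_one _

/-- The backward shift on `ℓ²`. -/
def backShift : ellTwo →L[ℂ] ellTwo := ContinuousLinearMap.adjoint shift

theorem norm_backShift_le : ‖backShift‖ ≤ 1 := by
  rw [backShift, LinearIsometryEquiv.norm_map]
  exact norm_shift_le

theorem shift_single (n : ℕ) (c : ℂ) :
    shift (lp.single 2 n c) = lp.single 2 (n + 1) c := by
  ext m
  rcases m with _ | m
  · rw [shift_apply_zero, lp.single_apply_ne _ _ _ (Nat.succ_ne_zero n).symm]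
  · simp [lp.single_apply, Pi.single_apply]

theorem inner_single_one_left (n : ℕ) (f : ellTwo) :
    inner ℂ (lp.single 2 n (1 : ℂ) : ellTwo) f = f n := by
  rw [lp.inner_single_left]; simp

@[simp]
theorem backShift_apply (f : ellTwo) (n : ℕ) : backShift f n = f (n + 1) := by
  rw [← inner_single_one_left n, backShift, ContinuousLinearMap.adjoint_inner_right, shift_single,
    inner_single_one_left]

theorem backShift_pow_apply (f : ellTwo) (m n : ℕ) : (backShift ^ m) f n = f (n + m) := by
  induction m generalizing n with
  | zero => simp
  | succ m ih => rw [pow_succ', mul_apply_eq_comp, backShift_apply, ih,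
      Nat.add_right_comm, Nat.add_assoc]

theorem norm_shift_pow_apply_le (f : ellTwo) (k m : ℕ) :
    ‖(shift ^ k) f m‖ ≤ if k ≤ m then ‖f‖ else 0 := by
  induction k generalizing m with
  | zero => simpa using lp.norm_apply_le_norm (by norm_num) f m
  | succ k ih =>
    rw [pow_succ', mul_apply_eq_comp]
    rcases m with _ | m
    · simp
    · simpa using ih m

theorem norm_aeval_shift_apply_le {P : Polynomial ℂ} {K : ℝ} (hP : ∀ k, ‖P.coeff k‖ ≤ K)
    (f : ellTwo) (m : ℕ) : ‖Polynomial.aeval shift P f m‖ ≤ (m + 1) * (K * ‖f‖) := by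
  have hK : 0 ≤ K := (norm_nonneg _).trans (hP 0)
  simp only [Polynomial.aeval_eq_sum_range, sum_apply, lp.coeFn_sum,
    Finset.sum_apply, smul_apply, lp.coeFn_smul, Pi.smul_apply]
  calc _ ≤ ∑ k ∈ Finset.range (P.natDegree + 1), if k ≤ m then K * ‖f‖ else 0 := by
        refine norm_sum_le_of_le _ fun k _ => ?_
        rw [norm_smul]
        refine (mul_le_mul (hP k) (norm_shift_pow_apply_le f k m) (norm_nonneg _) hK).trans ?_
        split_ifs <;> simp
    _ = ((Finset.range (P.natDegree + 1)).filter (· ≤ m)).card * (K * ‖f‖) := by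
        rw [← Finset.sum_filter, Finset.sum_const, nsmul_eq_mul]
    _ ≤ (m + 1) * (K * ‖f‖) := by
        gcongr
        have : ((Finset.range (P.natDegree + 1)).filter (· ≤ m)).card ≤
            (Finset.range (m + 1)).card :=
          Finset.card_le_card fun k hk => by
            rw [Finset.mem_filter] at hk; exact Finset.mem_range.2 (by omega)
        rw [Finset.card_range] at this
        exact_mod_cast this

theorem aeval_shift_tailPoly_single (a : ℕ → ℂ) (N : ℕ) :
    Polynomial.aeval shift (tailPoly a N 0) (lp.single 2 0 1) =
      ∑ n ∈ Finset.range N, lp.single 2 n (a n) := by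
  have h (n : ℕ) : (shift ^ n) (lp.single 2 0 1) = lp.single 2 n 1 := by
    induction n with
    | zero => simp
    | succ n ih => rw [pow_succ', mul_apply_eq_comp, ih, shift_single]
  simp only [tailPoly, map_sum, map_mul, map_pow, Polynomial.aeval_C, Polynomial.aeval_X,
    Algebra.algebraMap_eq_smul_one, smul_mul_assoc, one_mul, sum_apply,
    smul_apply, h, zero_add, Nat.sub_zero]
  refine Finset.sum_congr rfl fun n _ => ?_
  rw [← lp.single_smul]; simp

/-- A bounded family in `ℓ²` converging to `0` coordinatewise converges weakly to `0`. -/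
theorem tendsto_inner_zero_of_coord {ι : Type*} {l : Filter ι} {x : ι → ellTwo} {K : ℝ}
    (hK : ∀ i, ‖x i‖ ≤ K) (hx : ∀ m, Tendsto (fun i => x i m) l (nhds 0)) (b : ellTwo) :
    Tendsto (fun i => inner ℂ b (x i)) l (nhds 0) := by
  rcases isEmpty_or_nonempty ι with hι | ⟨⟨i₀⟩⟩
  · rw [Filter.filter_eq_bot_of_isEmpty l]; exact tendsto_bot
  have hK₀ : 0 ≤ K := (norm_nonneg _).trans (hK i₀)
  have hb := lp.hasSum_single (E := fun _ : ℕ => ℂ) (p := 2) (by norm_num) b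
  rw [HasSum, Metric.tendsto_nhds] at hb
  rw [Metric.tendsto_nhds]
  intro η hη
  obtain ⟨s, hs⟩ := (hb (η / (2 * (K + 1))) (by positivity)).exists
  have hfin : Tendsto (fun i => inner ℂ (∑ n ∈ s, (lp.single 2 n (b n) : ellTwo)) (x i)) l
      (nhds 0) := by
    simp only [sum_inner, lp.inner_single_left]
    have h := tendsto_finsetSum s fun n _ =>
      (tendsto_const_nhds (x := b n)).inner (𝕜 := ℂ) (hx n)
    simpa using h
  rw [Metric.tendsto_nhds] at hfin
  filter_upwards [hfin (η / 2) (by positivity)] with i hi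
  rw [dist_zero_right] at hi ⊢
  rw [dist_comm, dist_eq_norm] at hs
  have hsplit : inner ℂ b (x i) =
      inner ℂ (b - ∑ n ∈ s, (lp.single 2 n (b n) : ellTwo)) (x i) +
        inner ℂ (∑ n ∈ s, (lp.single 2 n (b n) : ellTwo)) (x i) := by
    rw [← inner_add_left, sub_add_cancel]
  have hrest : ‖inner ℂ (b - ∑ n ∈ s, (lp.single 2 n (b n) : ellTwo)) (x i)‖ ≤ η / 2 := by
    calc _ ≤ ‖b - ∑ n ∈ s, (lp.single 2 n (b n) : ellTwo)‖ * ‖x i‖ := norm_inner_le_norm _ _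
      _ ≤ η / (2 * (K + 1)) * (K + 1) := by
        gcongr
        linarith [hK i]
      _ = η / 2 := by field_simp
  rw [hsplit]
  linarith [norm_add_le (inner ℂ (b - ∑ n ∈ s, (lp.single 2 n (b n) : ellTwo)) (x i))
    (inner ℂ (∑ n ∈ s, (lp.single 2 n (b n) : ellTwo)) (x i))]

/-- The vector whose inner product with `f` is `(Γ_u f)(m)`. -/
def hankelRow (u : ellTwo) (m : ℕ) : ellTwo := star ((backShift ^ m) u)

theorem hankelRow_apply (u : ellTwo) (m n : ℕ) : hankelRow u m n = conj (u (n + m)) := by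
  rw [hankelRow, lp.star_apply, backShift_pow_apply]
  rfl

theorem inner_hankelRow (u f : ellTwo) (m : ℕ) :
    inner ℂ (hankelRow u m) f = hankel u f m := by
  rw [lp.inner_eq_tsum, hankel]
  refine tsum_congr fun n => ?_
  rw [hankelRow_apply, RCLike.inner_apply, Complex.conj_conj, mul_comm]

theorem hankel_shift (u f : ellTwo) (m : ℕ) : hankel u (shift f) m = hankel u f (m + 1) := by
  rw [← inner_hankelRow, ← inner_hankelRow, ← ContinuousLinearMap.adjoint_inner_left]
  congr 1
  ext n
  change backShift (hankelRow u m) n = _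
  rw [backShift_apply, hankelRow_apply, hankelRow_apply, Nat.add_right_comm, Nat.add_assoc]

theorem hankel_single_zero (u : ellTwo) (m : ℕ) :
    hankel u (lp.single 2 0 (1 : ℂ) : ellTwo) m = u m := by
  rw [← inner_hankelRow, lp.inner_single_right]
  rw [hankelRow_apply]
  simp

/-- The Hilbert space containing the graphs. -/
abbrev GraphSpace : Type := WithLp 2 (ellTwo × ellTwo)

/-- The shift in the first component and the backward shift in the second one. -/
def graphShift : GraphSpace →L[ℂ] GraphSpace :=
  (WithLp.prodContinuousLinearEquiv 2 ℂ ellTwo ellTwo).symm.toContinuousLinearMap ∘L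
    (shift.prodMap backShift) ∘L
      (WithLp.prodContinuousLinearEquiv 2 ℂ ellTwo ellTwo).toContinuousLinearMap

theorem graphShift_fst (x : GraphSpace) : (graphShift x).fst = shift x.fst := rfl

theorem graphShift_snd (x : GraphSpace) : (graphShift x).snd = backShift x.snd := rfl

theorem norm_graphShift_le : ‖graphShift‖ ≤ 1 := by
  refine ContinuousLinearMap.opNorm_le_bound _ zero_le_one fun x => ?_
  rw [one_mul, ← sq_le_sq₀ (norm_nonneg _) (norm_nonneg _), WithLp.prod_norm_sq_eq_of_L2,
    WithLp.prod_norm_sq_eq_of_L2, graphShift_fst, graphShift_snd]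
  have h₁ := shift.le_of_opNorm_le norm_shift_le x.fst
  have h₂ := backShift.le_of_opNorm_le norm_backShift_le x.snd
  rw [one_mul] at h₁ h₂
  gcongr

theorem aeval_graphShift_fst (P : Polynomial ℂ) (x : GraphSpace) :
    (Polynomial.aeval graphShift P x).fst = Polynomial.aeval shift P x.fst :=
  map_aeval_apply (WithLp.fstL 2 ℂ ellTwo ellTwo) graphShift_fst P x

theorem GraphSpace.norm_fst_le (x : GraphSpace) : ‖x.fst‖ ≤ ‖x‖ := by
  rw [← sq_le_sq₀ (norm_nonneg _) (norm_nonneg _), WithLp.prod_norm_sq_eq_of_L2]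
  linarith [sq_nonneg ‖x.snd‖]

theorem GraphSpace.norm_snd_le (x : GraphSpace) : ‖x.snd‖ ≤ ‖x‖ := by
  rw [← sq_le_sq₀ (norm_nonneg _) (norm_nonneg _), WithLp.prod_norm_sq_eq_of_L2]
  linarith [sq_nonneg ‖x.fst‖]

/-- The graph of the maximal Hankel operator. -/
def maxGraph (u : ellTwo) : Submodule ℂ GraphSpace where
  carrier := {x | ∀ m, x.snd m = inner ℂ (hankelRow u m) x.fst}
  add_mem' := fun {x y} hx hy m => by
    simp [← hx m, ← hy m]
  zero_mem' := fun m => by simp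
  smul_mem' := fun c x hx m => by
    simp [← hx m]

theorem mem_maxGraph {u : ellTwo} {x : GraphSpace} :
    x ∈ maxGraph u ↔ ∀ m, x.snd m = inner ℂ (hankelRow u m) x.fst := Iff.rfl

theorem mem_maxGraph_iff {u : ellTwo} {x : GraphSpace} :
    x ∈ maxGraph u ↔ ⇑x.snd = hankel u x.fst := by
  rw [mem_maxGraph, funext_iff]
  simp only [inner_hankelRow]

theorem isClosed_maxGraph (u : ellTwo) : IsClosed (maxGraph u : Set GraphSpace) := by
  have : (maxGraph u : Set GraphSpace) = ⋂ m, {x : GraphSpace |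
      inner ℂ (lp.single 2 m (1 : ℂ) : ellTwo) x.snd = inner ℂ (hankelRow u m) x.fst} := by
    ext x
    simp only [SetLike.mem_coe, mem_maxGraph, Set.mem_iInter, Set.mem_ofPred_eq,
      inner_single_one_left]
  rw [this]
  refine isClosed_iInter fun m => isClosed_eq ?_ ?_
  · exact continuous_const.inner (WithLp.sndL 2 ℂ ellTwo ellTwo).continuous
  · exact continuous_const.inner (WithLp.fstL 2 ℂ ellTwo ellTwo).continuous

theorem graphShift_mem_maxGraph {u : ellTwo} {x : GraphSpace} (hx : x ∈ maxGraph u) :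
    graphShift x ∈ maxGraph u := by
  rw [mem_maxGraph_iff] at hx ⊢
  funext m
  rw [graphShift_fst, graphShift_snd, hankel_shift, backShift_apply, hx]

/-- The point `(e₀, u)` of the graph of the Hankel operator. -/
def graphVacuum (u : ellTwo) : GraphSpace := WithLp.toLp 2 (lp.single 2 0 1, u)

theorem graphVacuum_mem_maxGraph (u : ellTwo) : graphVacuum u ∈ maxGraph u := by
  rw [mem_maxGraph_iff]
  funext m
  exact (hankel_single_zero u m).symm

/-- The part of the graph that lies over the finitely supported sequences. -/
def finGraph (u : ellTwo) : Submodule ℂ GraphSpace where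
  carrier := {x | x ∈ maxGraph u ∧ FinSupp x.fst}
  add_mem' := fun {x y} ⟨hx, N, hN⟩ ⟨hy, M, hM⟩ => ⟨add_mem hx hy, max N M, fun n hn => by
    simp [hN n (le_of_max_le_left hn), hM n (le_of_max_le_right hn)]⟩
  zero_mem' := ⟨zero_mem _, 0, fun n _ => by simp⟩
  smul_mem' := fun c x ⟨hx, N, hN⟩ => ⟨(maxGraph u).smul_mem c hx, N, fun n hn => by
    simp [hN n hn]⟩

theorem graphShift_mem_finGraph {u : ellTwo} {x : GraphSpace} (hx : x ∈ finGraph u) :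
    graphShift x ∈ finGraph u := by
  obtain ⟨hx, N, hN⟩ := hx
  refine ⟨graphShift_mem_maxGraph hx, N + 1, fun n hn => ?_⟩
  obtain ⟨k, rfl⟩ : ∃ k, n = k + 1 := ⟨n - 1, by omega⟩
  rw [graphShift_fst, shift_apply_succ]
  exact hN k (by omega)

theorem graphShift_mem_closure_finGraph {u : ellTwo} {x : GraphSpace}
    (hx : x ∈ (finGraph u).topologicalClosure) :
    graphShift x ∈ (finGraph u).topologicalClosure :=
  map_mem_closure graphShift.continuous hx fun _ => graphShift_mem_finGraph

theorem graphVacuum_mem_finGraph (u : ellTwo) : graphVacuum u ∈ finGraph u := by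
  refine ⟨graphVacuum_mem_maxGraph u, 1, fun n hn => ?_⟩
  exact lp.single_apply_ne _ _ _ (by omega)

theorem closure_finGraph_le (u : ellTwo) : (finGraph u).topologicalClosure ≤ maxGraph u :=
  (finGraph u).topologicalClosure_minimal (fun _ hx => hx.1) (isClosed_maxGraph u)

/-- On the graph, weak convergence follows from boundedness and coordinatewise convergence of the
first component. -/
theorem tendsto_inner_zero_of_mem_maxGraph {u : ellTwo} {ι : Type*} {l : Filter ι}
    {x : ι → GraphSpace} {K : ℝ} (hK : ∀ i, ‖x i‖ ≤ K) (hmem : ∀ i, x i ∈ maxGraph u)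
    (hx : ∀ m, Tendsto (fun i => (x i).fst m) l (nhds 0)) (b : GraphSpace) :
    Tendsto (fun i => inner ℂ b (x i)) l (nhds 0) := by
  have hfst := tendsto_inner_zero_of_coord (fun i => (GraphSpace.norm_fst_le (x i)).trans (hK i)) hx
  have hsnd := tendsto_inner_zero_of_coord (fun i => (GraphSpace.norm_snd_le (x i)).trans (hK i))
    (fun m => by simpa only [mem_maxGraph.1 (hmem _) m] using hfst (hankelRow u m))
  have hadd := (hfst b.fst).add (hsnd b.snd)
  rw [add_zero] at hadd
  exact hadd

/-- The regularizations of `x` at level `N` are, as `N → ∞`, asymptotically orthogonal to everything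
orthogonal to the finitely supported part of the graph. -/
theorem tendsto_inner_regularized {u : ellTwo} {x : GraphSpace} {t : ℝ} (ht : 0 < t)
    {z : ℕ → GraphSpace} (hz : ∀ N, z N ∈ maxGraph u)
    (hzx : ∀ N, Polynomial.aeval graphShift (regularizer x.fst N t) (z N) = x)
    {b : GraphSpace} (hb : b ∈ (finGraph u).topologicalClosureᗮ) :
    Tendsto (fun N => inner ℂ b (z N)) atTop (nhds 0) := by
  choose v hv hvx using fun N => exists_mem_aeval_regularizer_eq norm_graphShift_le
    (finGraph u).isClosed_topologicalClosure (fun _ => graphShift_mem_closure_finGraph)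
    x.fst N ht.le ((finGraph u).le_topologicalClosure (graphVacuum_mem_finGraph u))
  set y : ℕ → GraphSpace := fun N =>
    Polynomial.aeval graphShift (tailPoly x.fst N 0) (v N) with hy
  have hyV (N : ℕ) : y N ∈ (finGraph u).topologicalClosure :=
    aeval_apply_mem (fun _ => graphShift_mem_closure_finGraph) _ (hv N)
  have hyx (N : ℕ) : Polynomial.aeval graphShift (regularizer x.fst N t) (y N) =
      Polynomial.aeval graphShift (tailPoly x.fst N 0) (graphVacuum u) := by
    rw [← hvx N, hy]
    simp only [← mul_apply_eq_comp, ← map_mul]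
    rw [mul_comm]
  have hynorm (N : ℕ) : ‖y N‖ ≤ √(‖graphVacuum u‖ ^ 2 / t) := by
    refine Real.le_sqrt_of_sq_le ?_
    rw [le_div_iff₀' ht]
    simpa only [hvx N] using mul_norm_sq_aeval_tailPoly_le norm_graphShift_le x.fst N ht.le (v N)
  have hznorm (N : ℕ) : ‖z N‖ ≤ ‖x‖ := by
    simpa only [hzx N] using
      norm_le_norm_aeval_regularizer norm_graphShift_le x.fst N ht.le (z N)
  have hfst (N : ℕ) : ‖(z N - y N).fst‖ ≤
      ‖x.fst - ∑ n ∈ Finset.range N, (lp.single 2 n (x.fst n) : ellTwo)‖ := by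
    have h := norm_le_norm_aeval_regularizer norm_shift_le x.fst N ht.le (z N - y N).fst
    have hP : (Polynomial.aeval graphShift (tailPoly x.fst N 0) (graphVacuum u)).fst =
        ∑ n ∈ Finset.range N, (lp.single 2 n (x.fst n) : ellTwo) :=
      (aeval_graphShift_fst _ _).trans (aeval_shift_tailPoly_single _ N)
    rwa [← aeval_graphShift_fst, map_sub, hzx, hyx, WithLp.sub_fst x, hP] at h
  have hlim : Tendsto (fun N => ‖(z N - y N).fst‖) atTop (nhds 0) := by
    have h := (lp.hasSum_single (E := fun _ : ℕ => ℂ) (p := 2) (by norm_num)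
      x.fst).tendsto_sum_nat
    have h' := (tendsto_const_nhds (x := x.fst)).sub h |>.norm
    rw [sub_self, norm_zero] at h'
    exact squeeze_zero (fun _ => norm_nonneg _) hfst h'
  have hweak := tendsto_inner_zero_of_mem_maxGraph (x := fun N => z N - y N) (u := u) (l := atTop)
    (fun N => (norm_sub_le _ _).trans (add_le_add (hznorm N) (hynorm N)))
    (fun N => sub_mem (hz N) (closure_finGraph_le u (hyV N)))
    (fun m => squeeze_zero_norm (fun N => lp.norm_apply_le_norm (by norm_num) _ m) hlim) b
  refine hweak.congr fun N => ?_
  rw [inner_sub_right, Submodule.inner_left_of_mem_orthogonal (hyV N) hb, sub_zero]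

theorem maxGraph_le_closure_finGraph (u : ellTwo) :
    maxGraph u ≤ (finGraph u).topologicalClosure := by
  intro x hx
  have hcl := (finGraph u).isClosed_topologicalClosure
  have : CompleteSpace (finGraph u).topologicalClosure := hcl.completeSpace_coe
  rw [← Submodule.orthogonal_orthogonal (finGraph u).topologicalClosure,
    Submodule.mem_orthogonal]
  intro b hb
  have ht (j : ℕ) : (0 : ℝ) < 1 / ((j : ℝ) + 1) := by positivity
  choose z hz hzx using fun j N => exists_mem_aeval_regularizer_eq norm_graphShift_le
    (isClosed_maxGraph u) (fun _ => graphShift_mem_maxGraph) x.fst N (ht j).le hx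
  choose N hN using fun j => ((Metric.tendsto_nhds.1
    (tendsto_inner_regularized (ht j) (hz j) (hzx j) hb) _ (ht j)).exists)
  have hznorm (j : ℕ) : ‖z j (N j)‖ ≤ ‖x‖ := by
    simpa only [hzx] using
      norm_le_norm_aeval_regularizer norm_graphShift_le x.fst (N j) (ht j).le (z j (N j))
  have hlim : Tendsto (fun j : ℕ => 1 / ((j : ℝ) + 1)) atTop (nhds 0) :=
    tendsto_one_div_add_atTop_nhds_zero_nat
  have hcoord (m : ℕ) : Tendsto (fun j => (x - z j (N j)).fst m) atTop (nhds 0) := by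
    refine squeeze_zero_norm (a := fun j : ℕ => 1 / ((j : ℝ) + 1) *
      ((m + 1) * (3 * ‖x.fst‖ ^ 2 * ‖x‖))) (fun j => ?_) (by simpa using hlim.mul_const _)
    have h := aeval_regularizer_apply graphShift x.fst (N j) (1 / ((j : ℝ) + 1)) (z j (N j))
    rw [hzx] at h
    have h' : (x - z j (N j)).fst = ((1 / ((j : ℝ) + 1) : ℝ) : ℂ) •
        Polynomial.aeval shift (herglotzPoly x.fst (N j)) (z j (N j)).fst := by
      rw [← aeval_graphShift_fst, ← WithLp.smul_fst]
      congr 1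
      exact sub_eq_of_eq_add' h
    rw [h', lp.coeFn_smul, Pi.smul_apply, norm_smul, Complex.norm_real, Real.norm_eq_abs,
      abs_of_pos (ht j)]
    refine mul_le_mul_of_nonneg_left ?_ (ht j).le
    refine (norm_aeval_shift_apply_le (norm_coeff_herglotzPoly_le x.fst (N j)) _ m).trans ?_
    gcongr
    exact (GraphSpace.norm_fst_le (z j (N j))).trans (hznorm j)
  have hweak := tendsto_inner_zero_of_mem_maxGraph (x := fun j => x - z j (N j)) (u := u)
    (l := atTop) (fun j => (norm_sub_le _ _).trans (add_le_add le_rfl (hznorm j)))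
    (fun j => sub_mem hx (hz j (N j))) hcoord b
  have hinner : Tendsto (fun j => inner ℂ b (z j (N j))) atTop (nhds 0) :=
    squeeze_zero_norm (fun j => by simpa only [dist_zero_right] using (hN j).le) hlim
  have hsum := hweak.add hinner
  simp only [inner_sub_right, sub_add_cancel, add_zero] at hsum
  exact tendsto_nhds_unique tendsto_const_nhds hsum

/-- Finitely supported sequences are dense in `Dom Γ_u` for the graph norm: for every
`f ∈ Dom Γ_u` and `ε > 0` there is a finitely supported `p` with
`‖f - p‖² + ‖Γ_u f - Γ_u p‖² < ε²`. -/
theorem stmt_2 (u : ellTwo) (f : ellTwo) (hf : Memℓp (hankel (⇑u) (⇑f)) 2)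
    (ε : ℝ) (hε : 0 < ε) :
    ∃ (p : ellTwo) (_ : FinSupp (⇑p)) (hp : Memℓp (hankel (⇑u) (⇑p)) 2),
      ‖f - p‖ ^ 2 +
        ‖(⟨hankel (⇑u) (⇑f), hf⟩ : ellTwo) - (⟨hankel (⇑u) (⇑p), hp⟩ : ellTwo)‖ ^ 2
        < ε ^ 2 := by
  have hx : (WithLp.toLp 2 (f, ⟨hankel u f, hf⟩) : GraphSpace) ∈
      (finGraph u).topologicalClosure :=
    maxGraph_le_closure_finGraph u (mem_maxGraph_iff.2 rfl)
  obtain ⟨y, ⟨hy, hfin⟩, hdist⟩ := Metric.mem_closure_iff.1 hx ε hε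
  have hyeq := mem_maxGraph_iff.1 hy
  have hp : Memℓp (hankel u y.fst) 2 := hyeq ▸ lp.memℓp y.snd
  have hsnd : y.snd = (⟨hankel u y.fst, hp⟩ : ellTwo) := lp.ext hyeq
  refine ⟨y.fst, hfin, hp, ?_⟩
  rw [dist_eq_norm, ← sq_lt_sq₀ (norm_nonneg _) hε.le, WithLp.prod_norm_sq_eq_of_L2,
    WithLp.sub_fst, WithLp.sub_snd, hsnd] at hdist
  exact hdist
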